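/- arXiv:2011.09288 — 4 statements merged into one kernel-verified Lean document; each statement's English description precedes it below -/
import Mathlib

section
/- Van Trees' inequality (Bayesian Cramér–Rao, multivariate form): Let λ : ℝᵖ → ℝ be a smooth, compactly supported probability density (the prior), and for each θ ∈ supp λ let p(·|θ) be a strictly positive probability density on ℝⁿ, jointly measurable in (x, θ) and continuously differentiable in θ on the support of λ, such that the score has mean zero: ∫ ∇_θ p(x|θ) dx = 0 for all θ ∈ supp λ. Let I(θ) = ∫ ∇_θ log p(x|θ) (∇_θ log p(x|θ))ᵀ p(x|θ) dx and J(λ) = ∫ ∇ log λ(θ) (∇ log λ(θ))ᵀ λ(θ) dθ, assume J(λ) is finite, that θ ↦ I(θ) is continuous on supp λ, and that ∫ I(θ) λ(θ) dθ + J(λ) is invertible. Let ψ : ℝᵖ → ℝᵏ be differentiable with Jacobian Dψ(θ), and let ψ̂ : ℝⁿ → ℝᵏ be measurable with all quantities below integrable with respect to the joint density p(x|θ)λ(θ). Then E[(ψ̂(X) − ψ(θ))(ψ̂(X) − ψ(θ))ᵀ] ⪰ E[Dψ(θ)] (E[I(θ)] + J(λ))⁻¹ (E[Dψ(θ)])ᵀ,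 where E denotes expectation under the joint density p(x|θ)λ(θ) on ℝⁿ × ℝᵖ. -/
open MeasureTheory Matrix

noncomputable section

/-- Score of the likelihood `θ ↦ p(x|θ)` in coordinate direction `i`:
`∂_{θ_i} log p(x|θ) = ∂_{θ_i} p(x|θ) / p(x|θ)`. -/
def densScore {dn dp : ℕ} (dens : (Fin dn → ℝ) → (Fin dp → ℝ) → ℝ)
    (x : Fin dn → ℝ) (θ : Fin dp → ℝ) (i : Fin dp) : ℝ :=
  fderiv ℝ (fun θ' => dens x θ') θ (Pi.single i 1) / dens x θ

/-- Fisher information matrix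
`I(θ) = ∫ ∇_θ log p(x|θ) (∇_θ log p(x|θ))ᵀ p(x|θ) dx`. -/
def fisherInfo {dn dp : ℕ} (dens : (Fin dn → ℝ) → (Fin dp → ℝ) → ℝ)
    (θ : Fin dp → ℝ) : Matrix (Fin dp) (Fin dp) ℝ :=
  Matrix.of fun i j => ∫ x, densScore dens x θ i * densScore dens x θ j * dens x θ

/-- Score of the prior: `∂_{θ_i} log λ(θ) = ∂_{θ_i} λ(θ) / λ(θ)`. -/
def priorScore {dp : ℕ} (prior : (Fin dp → ℝ) → ℝ) (θ : Fin dp → ℝ) (i : Fin dp) : ℝ :=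
  fderiv ℝ prior θ (Pi.single i 1) / prior θ

/-- Location information of the prior:
`J(λ) = ∫ ∇ log λ(θ) (∇ log λ(θ))ᵀ λ(θ) dθ`. -/
def priorInfo {dp : ℕ} (prior : (Fin dp → ℝ) → ℝ) : Matrix (Fin dp) (Fin dp) ℝ :=
  Matrix.of fun i j => ∫ θ, priorScore prior θ i * priorScore prior θ j * prior θ

/-- Jacobian matrix `Dψ(θ)` of a map `ψ : ℝᵖ → ℝᵏ`. -/
def jacobianMat {dp k : ℕ} (ψ : (Fin dp → ℝ) → (Fin k → ℝ)) (θ : Fin dp → ℝ) :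
    Matrix (Fin k) (Fin dp) ℝ :=
  Matrix.of fun a i => fderiv ℝ ψ θ (Pi.single i 1) a


/-- The Schur complement of an invertible diagonal block of the Gram matrix of a family of
square-integrable functions is positive semidefinite. -/
lemma posSemidef_schur_complement_integral_mul {α κ ι : Type*} [MeasurableSpace α] {μ : Measure α}
    [Fintype κ] [Fintype ι] [DecidableEq ι] {F : κ → α → ℝ} {T : ι → α → ℝ}
    (hF : ∀ a, MemLp (F a) 2 μ) (hT : ∀ i, MemLp (T i) 2 μ)
    (hdet : IsUnit (Matrix.of fun i j => ∫ q, T i q * T j q ∂μ : Matrix ι ι ℝ).det) :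
    ((Matrix.of fun a b => ∫ q, F a q * F b q ∂μ)
      - (Matrix.of fun a i => ∫ q, F a q * T i q ∂μ)
        * (Matrix.of fun i j => ∫ q, T i q * T j q ∂μ)⁻¹
        * (Matrix.of fun a i => ∫ q, F a q * T i q ∂μ)ᵀ).PosSemidef := by
  classical
  have inner_toLp {f g : α → ℝ} (hf : MemLp f 2 μ) (hg : MemLp g 2 μ) :
      inner ℝ (hf.toLp f) (hg.toLp g) = ∫ q, f q * g q ∂μ := by
    rw [L2.inner_def]
    refine integral_congr_ae ?_
    filter_upwards [hf.coeFn_toLp, hg.coeFn_toLp] with q h1 h2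
    simp [h1, h2, mul_comm]
  have hposA : (Matrix.of fun i j => ∫ q, T i q * T j q ∂μ : Matrix ι ι ℝ).PosSemidef := by
    have h : (Matrix.of fun i j => ∫ q, T i q * T j q ∂μ : Matrix ι ι ℝ)
        = Matrix.gram ℝ (fun i => (hT i).toLp (T i)) := by
      ext i j
      simp [Matrix.gram_apply, inner_toLp]
    rw [h]
    exact Matrix.posSemidef_gram ℝ _
  have hA := hposA.posDef_iff_isUnit.2 ((Matrix.isUnit_iff_isUnit_det _).2 hdet)
  have : Invertible (Matrix.of fun i j => ∫ q, T i q * T j q ∂μ : Matrix ι ι ℝ) :=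
    Matrix.invertibleOfIsUnitDet _ hdet
  have key := Matrix.PosDef.fromBlocks₂₂ (Matrix.of fun a b => ∫ q, F a q * F b q ∂μ)
    (Matrix.of fun a i => ∫ q, F a q * T i q ∂μ) hA
  rw [Matrix.conjTranspose_eq_transpose_of_trivial] at key
  have h : Matrix.fromBlocks (Matrix.of fun a b => ∫ q, F a q * F b q ∂μ)
      (Matrix.of fun a i => ∫ q, F a q * T i q ∂μ) (Matrix.of fun a i => ∫ q, F a q * T i q ∂μ)ᵀ
      (Matrix.of fun i j => ∫ q, T i q * T j q ∂μ)
      = Matrix.gram ℝ (Sum.elim (fun a => (hF a).toLp (F a)) (fun i => (hT i).toLp (T i))) := by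
    ext (a | i) (b | j) <;> simp [Matrix.gram_apply, inner_toLp, mul_comm]
  refine key.1 ?_
  rw [h]
  exact Matrix.posSemidef_gram ℝ _

/-- At a zero of a nonnegative compactly supported differentiable function `p`, the product of `p`
with any function continuous on the support of `p` has vanishing derivative. -/
lemma hasFDerivAt_mul_zero_of_nonneg {E : Type*} [NormedAddCommGroup E] [NormedSpace ℝ E]
    {f p : E → ℝ} {θ : E} (hf : ContinuousOn f (tsupport p)) (hp : HasCompactSupport p)
    (hp0 : ∀ y, 0 ≤ p y) (hd : DifferentiableAt ℝ p θ) (hθ : p θ = 0) :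
    HasFDerivAt (fun y => f y * p y) (0 : E →L[ℝ] ℝ) θ := by
  obtain ⟨C, hC⟩ := IsCompact.exists_bound_of_continuousOn hp hf
  have hmin : IsLocalMin p θ := .of_forall fun y => hθ ▸ hp0 y
  have h1 := hd.hasFDerivAt
  rw [hmin.fderiv_eq_zero, hasFDerivAt_iff_isLittleO] at h1
  rw [hasFDerivAt_iff_isLittleO]
  simp only [hθ, mul_zero, sub_zero, _root_.zero_apply] at h1 ⊢
  refine (Asymptotics.IsBigO.of_bound C (.of_forall fun y => ?_)).trans_isLittleO h1
  by_cases hy : y ∈ tsupport p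
  · rw [norm_mul]
    exact mul_le_mul_of_nonneg_right (hC y hy) (norm_nonneg _)
  · simp [image_eq_zero_of_notMem_tsupport hy]

/-- Partial derivatives of a jointly measurable function are jointly measurable where they
exist. -/
lemma measurable_indicator_fderiv_apply {X E : Type*} [MeasurableSpace X] [NormedAddCommGroup E]
    [NormedSpace ℝ E] [MeasurableSpace E] [BorelSpace E] {f : X → E → ℝ} {U : Set E}
    (hf : Measurable (Function.uncurry f)) (hU : MeasurableSet U)
    (hd : ∀ x, ∀ θ ∈ U, DifferentiableAt ℝ (f x) θ) (v : E) :
    Measurable fun q : X × E => U.indicator (fun θ => fderiv ℝ (f q.1) θ v) q.2 := by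
  refine measurable_of_tendsto_metrizable (f := fun (m : ℕ) (q : X × E) =>
    U.indicator (fun θ => (m : ℝ) • (f q.1 (θ + (m : ℝ)⁻¹ • v) - f q.1 θ)) q.2) (fun m => ?_) ?_
  · have h1 : Measurable fun q : X × E => (m : ℝ) • (f q.1 (q.2 + (m : ℝ)⁻¹ • v) - f q.1 q.2) := by
      have h2 : Measurable fun q : X × E => (q.1, q.2 + (m : ℝ)⁻¹ • v) :=
        measurable_fst.prodMk ((continuous_add_const _).measurable.comp measurable_snd)
      exact ((hf.comp h2).sub hf).const_smul (m : ℝ)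
    exact h1.indicator (measurable_snd hU)
  · rw [tendsto_pi_nhds]
    rintro ⟨x, θ⟩
    by_cases hθ : θ ∈ U
    · simp only [Set.indicator_of_mem hθ]
      refine (hd x θ hθ).hasFDerivAt.lim_real v |>.comp tendsto_natCast_atTop_atTop
    · simp [Set.indicator_of_notMem hθ]

/-- A nonnegative function on a product is integrable if its marginal is. -/
lemma integrable_prod_of_nonneg {X Θ : Type*} [MeasurableSpace X] [MeasurableSpace Θ]
    {μ : Measure X} {ν : Measure Θ} [SFinite μ] [SFinite ν] {f : X × Θ → ℝ}
    (hf : AEStronglyMeasurable f (μ.prod ν)) (h0 : ∀ q, 0 ≤ f q)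
    (hx : ∀ θ, Integrable (fun x => f (x, θ)) μ)
    (hm : Integrable (fun θ => ∫ x, f (x, θ) ∂μ) ν) : Integrable f (μ.prod ν) := by
  rw [integrable_prod_iff' hf]
  exact ⟨.of_forall hx, by simpa only [Real.norm_of_nonneg (h0 _)] using hm⟩

/-- A function of the parameter alone is integrable under the joint density as soon as it is
integrable under the prior. -/
lemma integrable_mul_joint {X Θ : Type*} [MeasurableSpace X] [MeasurableSpace Θ]
    {μ : Measure X} {ν : Measure Θ} [SFinite μ] [SFinite ν] {w p : Θ → ℝ} {f : X → Θ → ℝ}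
    (hw : Measurable w) (hp : Measurable p) (hf : Measurable (Function.uncurry f))
    (hwp : Integrable (fun θ => w θ * p θ) ν)
    (hf0 : ∀ x θ, p θ ≠ 0 → 0 ≤ f x θ) (hf1 : ∀ θ, p θ ≠ 0 → ∫ x, f x θ ∂μ = 1) :
    Integrable (fun q : X × Θ => w q.2 * (f q.1 q.2 * p q.2)) (μ.prod ν) := by
  have hm : Measurable fun q : X × Θ => w q.2 * (f q.1 q.2 * p q.2) :=
    (hw.comp measurable_snd).mul (hf.mul (hp.comp measurable_snd))
  have hfi (θ : Θ) (hθ : p θ ≠ 0) : Integrable (fun x => f x θ) μ :=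
    .of_integral_ne_zero (by simp [hf1 θ hθ])
  have hrw (x : X) (θ : Θ) : |w θ * (f x θ * p θ)| = |w θ * p θ| * f x θ := by
    by_cases h : p θ = 0
    · simp [h]
    · rw [abs_mul, abs_mul, abs_mul, abs_of_nonneg (hf0 x θ h)]; ring
  refine (integrable_norm_iff hm.aestronglyMeasurable).1 ?_
  refine integrable_prod_of_nonneg hm.norm.aestronglyMeasurable (fun _ => norm_nonneg _) ?_ ?_
  · intro θ
    simp only [Real.norm_eq_abs, hrw]
    by_cases h : p θ = 0
    · simp [h]
    · exact (hfi θ h).const_mul _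
  · refine hwp.norm.congr (.of_forall fun θ => ?_)
    simp only [Real.norm_eq_abs, hrw]
    rw [integral_const_mul]
    by_cases h : p θ = 0
    · simp [h]
    · rw [hf1 θ h, mul_one]

/-- The expectation of a function of the parameter alone under the joint density is its
expectation under the prior. -/
lemma integral_mul_joint {X Θ : Type*} [MeasurableSpace X] [MeasurableSpace Θ]
    {μ : Measure X} {ν : Measure Θ} [SFinite μ] [SFinite ν] {w p : Θ → ℝ} {f : X → Θ → ℝ}
    (hw : Measurable w) (hp : Measurable p) (hf : Measurable (Function.uncurry f))
    (hwp : Integrable (fun θ => w θ * p θ) ν)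
    (hf0 : ∀ x θ, p θ ≠ 0 → 0 ≤ f x θ) (hf1 : ∀ θ, p θ ≠ 0 → ∫ x, f x θ ∂μ = 1) :
    ∫ q : X × Θ, w q.2 * (f q.1 q.2 * p q.2) ∂(μ.prod ν) = ∫ θ, w θ * p θ ∂ν := by
  rw [integral_prod_symm _ (integrable_mul_joint hw hp hf hwp hf0 hf1)]
  refine integral_congr_ae (.of_forall fun θ => ?_)
  simp only [integral_const_mul, integral_mul_const]
  by_cases h : p θ = 0
  · simp [h]
  · rw [hf1 θ h, one_mul]

/-- **Van Trees' inequality (Bayesian Cramér–Rao, multivariate form).**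
Under the stated regularity hypotheses on the smooth compactly supported prior `λ`, the
strictly positive likelihoods `p(·|θ)` with zero-mean score, the differentiable
functional `ψ` and the measurable estimator `ψ̂`, one has
`E[(ψ̂(X) − ψ(θ))(ψ̂(X) − ψ(θ))ᵀ] ⪰ E[Dψ(θ)] (E[I(θ)] + J(λ))⁻¹ (E[Dψ(θ)])ᵀ`,
where `E` is the expectation under the joint density `p(x|θ)λ(θ)`. -/
theorem van_trees_inequality {dn dp k : ℕ}
    (prior : (Fin dp → ℝ) → ℝ)
    (dens : (Fin dn → ℝ) → (Fin dp → ℝ) → ℝ)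
    (ψ : (Fin dp → ℝ) → (Fin k → ℝ)) (est : (Fin dn → ℝ) → (Fin k → ℝ))
    (hprior_smooth : ContDiff ℝ (⊤ : ℕ∞) prior)
    (hprior_supp : HasCompactSupport prior)
    (hprior_nonneg : ∀ θ, 0 ≤ prior θ)
    (hprior_prob : ∫ θ, prior θ = 1)
    (hdens_meas : Measurable (Function.uncurry dens))
    (hdens_pos : ∀ x, ∀ θ ∈ tsupport prior, 0 < dens x θ)
    (hdens_prob : ∀ θ ∈ tsupport prior, ∫ x, dens x θ = 1)
    (hdens_diff : ∀ x, ContDiffOn ℝ 1 (fun θ' => dens x θ') (tsupport prior))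
    (hscore_mean : ∀ θ ∈ tsupport prior, ∀ i,
        ∫ x, fderiv ℝ (fun θ' => dens x θ') θ (Pi.single i 1) = 0)
    (hJ_fin : ∀ i j, Integrable fun θ =>
        priorScore prior θ i * priorScore prior θ j * prior θ)
    (hI_fin : ∀ θ ∈ tsupport prior, ∀ i j,
        Integrable fun x => densScore dens x θ i * densScore dens x θ j * dens x θ)
    (hI_cont : ∀ i j, ContinuousOn (fun θ => fisherInfo dens θ i j) (tsupport prior))
    (hEI_fin : ∀ i j, Integrable fun θ => fisherInfo dens θ i j * prior θ)
    (hψ : Differentiable ℝ ψ)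
    (hest : Measurable est)
    (hEDψ_fin : ∀ a i, Integrable fun θ => jacobianMat ψ θ a i * prior θ)
    (herr_fin : ∀ a b, Integrable fun q : (Fin dn → ℝ) × (Fin dp → ℝ) =>
        (est q.1 a - ψ q.2 a) * (est q.1 b - ψ q.2 b) * (dens q.1 q.2 * prior q.2))
    (hinv : IsUnit ((Matrix.of fun i j => ∫ θ, fisherInfo dens θ i j * prior θ)
        + priorInfo prior : Matrix (Fin dp) (Fin dp) ℝ).det) :
    ((Matrix.of fun a b : Fin k => ∫ q : (Fin dn → ℝ) × (Fin dp → ℝ),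
        (est q.1 a - ψ q.2 a) * (est q.1 b - ψ q.2 b) * (dens q.1 q.2 * prior q.2))
      - (Matrix.of fun (a : Fin k) (i : Fin dp) => ∫ θ, jacobianMat ψ θ a i * prior θ)
        * ((Matrix.of fun i j : Fin dp => ∫ θ, fisherInfo dens θ i j * prior θ)
            + priorInfo prior)⁻¹
        * (Matrix.of fun (a : Fin k) (i : Fin dp) =>
            ∫ θ, jacobianMat ψ θ a i * prior θ)ᵀ).PosSemidef := by
  have hU : IsOpen (Function.support prior) := hprior_smooth.continuous.isOpen_support
  have hpm : Measurable prior := hprior_smooth.continuous.measurable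
  have hpd : Differentiable ℝ prior := hprior_smooth.differentiable (by simp)
  have hdd (x : Fin dn → ℝ) (θ : Fin dp → ℝ) (hθ : θ ∈ Function.support prior) :
      DifferentiableAt ℝ (dens x) θ :=
    ((hdens_diff x).differentiableOn one_ne_zero).differentiableAt
      (Filter.mem_of_superset (hU.mem_nhds hθ) (subset_tsupport prior))
  have hpos (x : Fin dn → ℝ) (θ : Fin dp → ℝ) (hθ : prior θ ≠ 0) : 0 < dens x θ :=
    hdens_pos x θ (subset_tsupport prior hθ)
  have hprob (θ : Fin dp → ℝ) (hθ : prior θ ≠ 0) : ∫ x, dens x θ = 1 :=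
    hdens_prob θ (subset_tsupport prior hθ)
  have hpos' x θ hθ := (hpos x θ hθ).le
  -- The joint density and its derivative in the parameter.
  set g : (Fin dn → ℝ) × (Fin dp → ℝ) → ℝ := fun q => dens q.1 q.2 * prior q.2 with hg
  have hgm : Measurable g := hdens_meas.mul (hpm.comp measurable_snd)
  have hg0 (q) : 0 ≤ g q := by
    by_cases h : prior q.2 = 0
    · simp [hg, h]
    · exact mul_nonneg (hpos' _ _ h) (hprior_nonneg _)
  have hgd (x : Fin dn → ℝ) : Differentiable ℝ fun θ => g (x, θ) := by
    intro θ
    by_cases h : prior θ = 0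
    · exact (hasFDerivAt_mul_zero_of_nonneg (hdens_diff x).continuousOn hprior_supp
        hprior_nonneg (hpd θ) h).differentiableAt
    · exact (hdd x θ h).mul (hpd θ)
  have hgs (x : Fin dn → ℝ) (θ : Fin dp → ℝ) (i : Fin dp) :
      (densScore dens x θ i + priorScore prior θ i) * g (x, θ)
        = fderiv ℝ (fun θ' => g (x, θ')) θ (Pi.single i 1) := by
    by_cases h : prior θ = 0
    · rw [(hasFDerivAt_mul_zero_of_nonneg (hdens_diff x).continuousOn hprior_supp
        hprior_nonneg (hpd θ) h).fderiv]
      simp [hg, h]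
    · have hd := (hpos x θ h).ne'
      have h1 : fderiv ℝ (fun θ' => g (x, θ')) θ = _ := fderiv_fun_mul (hdd x θ h) (hpd θ)
      rw [h1]
      simp only [densScore, priorScore, hg, _root_.add_apply, _root_.smul_apply, smul_eq_mul]
      field_simp
      ring
  have hsq (q) : √(g q) * √(g q) = g q := Real.mul_self_sqrt (hg0 q)
  have hsm : Measurable fun q => √(g q) := hgm.sqrt
  have sq_int {f : (Fin dn → ℝ) × (Fin dp → ℝ) → ℝ} (hf : Measurable f)
      (hfg : Integrable fun q => f q * f q * g q) :
      MemLp (fun q => f q * √(g q)) 2 volume := by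
    refine (memLp_two_iff_integrable_sq (hf.mul hsm).aestronglyMeasurable).2
      (hfg.congr (.of_forall fun q => ?_))
    simp only [pow_two, Pi.mul_apply, mul_mul_mul_comm, hsq]
  have mul_int {f h : (Fin dn → ℝ) × (Fin dp → ℝ) → ℝ} (hf : MemLp f 2 volume)
      (hh : MemLp h 2 volume) : Integrable fun q => f q * h q := hf.integrable_mul hh
  have mul_eq (a b : ℝ) (q) : a * √(g q) * (b * √(g q)) = a * b * g q := by
    rw [mul_mul_mul_comm, hsq]
  have hF (a : Fin k) : MemLp (fun q : (Fin dn → ℝ) × (Fin dp → ℝ) =>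
      (est q.1 a - ψ q.2 a) * √(g q)) 2 volume := by
    refine sq_int ?_ (herr_fin a a)
    exact (((measurable_pi_apply a).comp hest).comp measurable_fst).sub
      (((measurable_pi_apply a).comp hψ.continuous.measurable).comp measurable_snd)
  have hprior_score_meas (i : Fin dp) : Measurable fun θ => priorScore prior θ i :=
    (measurable_fderiv_apply_const ℝ prior _).div hpm
  have hQ (i : Fin dp) : MemLp (fun q : (Fin dn → ℝ) × (Fin dp → ℝ) =>
      priorScore prior q.2 i * √(g q)) 2 volume :=
    sq_int ((hprior_score_meas i).comp measurable_snd)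
      (integrable_mul_joint ((hprior_score_meas i).mul (hprior_score_meas i)) hpm hdens_meas
        (hJ_fin i i) hpos' hprob)
  have hP (i : Fin dp) : MemLp (fun q : (Fin dn → ℝ) × (Fin dp → ℝ) =>
      densScore dens q.1 q.2 i * √(g q)) 2 volume := by
    set D : (Fin dn → ℝ) × (Fin dp → ℝ) → ℝ := fun q => (Function.support prior).indicator
      (fun θ => fderiv ℝ (dens q.1) θ (Pi.single i 1)) q.2 / dens q.1 q.2 with hD
    have hDm : Measurable D := (measurable_indicator_fderiv_apply hdens_meas hU.measurableSet
      hdd (Pi.single i 1)).div hdens_meas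
    have hDeq (q) (hq : prior q.2 ≠ 0) : D q = densScore dens q.1 q.2 i := by
      simp only [hD, densScore]
      rw [Set.indicator_of_mem (by exact hq)]
    have hDP : (fun q : (Fin dn → ℝ) × (Fin dp → ℝ) => densScore dens q.1 q.2 i * √(g q))
        = fun q => D q * √(g q) := by
      funext q
      by_cases h : prior q.2 = 0
      · simp [hg, h]
      · rw [hDeq q h]
    rw [hDP]
    refine sq_int hDm (integrable_prod_of_nonneg ((hDm.mul hDm).mul hgm).aestronglyMeasurable
      (fun q => mul_nonneg (mul_self_nonneg _) (hg0 q)) (fun θ => ?_) ?_)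
    · by_cases h : prior θ = 0
      · simp [hg, h]
      · refine ((hI_fin θ (subset_tsupport prior h) i i).mul_const (prior θ)).congr
          (.of_forall fun x => ?_)
        simp only [hg, hDeq (x, θ) h]
        ring
    · refine (hEI_fin i i).congr (.of_forall fun θ => ?_)
      by_cases h : prior θ = 0
      · simp [hg, h]
      · simp only [fisherInfo, Matrix.of_apply, ← integral_mul_const]
        refine integral_congr_ae (.of_forall fun x => ?_)
        simp only [hg, hDeq (x, θ) h]
        ring
  have hPP (i j : Fin dp) : ∫ q : (Fin dn → ℝ) × (Fin dp → ℝ),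
      densScore dens q.1 q.2 i * √(g q) * (densScore dens q.1 q.2 j * √(g q))
        = ∫ θ, fisherInfo dens θ i j * prior θ := by
    refine (integral_prod_symm _ (mul_int (hP i) (hP j))).trans ?_
    refine integral_congr_ae (.of_forall fun θ => ?_)
    simp only [mul_eq]
    simp only [fisherInfo, Matrix.of_apply, ← integral_mul_const, hg, mul_assoc]
  have hQQ (i j : Fin dp) : ∫ q : (Fin dn → ℝ) × (Fin dp → ℝ),
      priorScore prior q.2 i * √(g q) * (priorScore prior q.2 j * √(g q))
        = priorInfo prior i j := by
    simp only [mul_eq]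
    exact integral_mul_joint ((hprior_score_meas i).mul (hprior_score_meas j)) hpm hdens_meas
        (hJ_fin i j) hpos' hprob
  have hPQ (i j : Fin dp) : ∫ q : (Fin dn → ℝ) × (Fin dp → ℝ),
      densScore dens q.1 q.2 i * √(g q) * (priorScore prior q.2 j * √(g q)) = 0 := by
    refine (integral_prod_symm _ (mul_int (hP i) (hQ j))).trans ?_
    refine integral_eq_zero_of_ae (.of_forall fun θ => ?_)
    simp only [mul_eq, Pi.zero_apply]
    by_cases h : prior θ = 0
    · simp [hg, h]
    · have h1 (x : Fin dn → ℝ) : densScore dens x θ i * priorScore prior θ j * g (x, θ)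
          = fderiv ℝ (fun θ' => dens x θ') θ (Pi.single i 1)
            * (priorScore prior θ j * prior θ) := by
        have hd := (hpos x θ h).ne'
        simp only [densScore, hg]
        field_simp
      simp only [h1, integral_mul_const, hscore_mean θ (subset_tsupport prior h) i, zero_mul]
  -- The joint score.
  have hT (i : Fin dp) : MemLp (fun q : (Fin dn → ℝ) × (Fin dp → ℝ) =>
      (densScore dens q.1 q.2 i + priorScore prior q.2 i) * √(g q)) 2 volume := by
    simp only [add_mul]
    exact (hP i).add (hQ i)
  have hTT : (Matrix.of fun i j => ∫ q : (Fin dn → ℝ) × (Fin dp → ℝ),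
      (densScore dens q.1 q.2 i + priorScore prior q.2 i) * √(g q)
        * ((densScore dens q.1 q.2 j + priorScore prior q.2 j) * √(g q)))
      = (Matrix.of fun i j => ∫ θ, fisherInfo dens θ i j * prior θ) + priorInfo prior := by
    ext i j
    simp only [Matrix.add_apply, Matrix.of_apply]
    have hsplit (q : (Fin dn → ℝ) × (Fin dp → ℝ)) :
        (densScore dens q.1 q.2 i + priorScore prior q.2 i) * √(g q)
          * ((densScore dens q.1 q.2 j + priorScore prior q.2 j) * √(g q))
        = (densScore dens q.1 q.2 i * √(g q) * (densScore dens q.1 q.2 j * √(g q))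
          + densScore dens q.1 q.2 i * √(g q) * (priorScore prior q.2 j * √(g q)))
          + (densScore dens q.1 q.2 j * √(g q) * (priorScore prior q.2 i * √(g q))
          + priorScore prior q.2 i * √(g q) * (priorScore prior q.2 j * √(g q))) := by ring
    have i1 := mul_int (hP i) (hP j)
    have i2 := mul_int (hP i) (hQ j)
    have i3 := mul_int (hP j) (hQ i)
    have i4 := mul_int (hQ i) (hQ j)
    simp only [hsplit]
    refine (integral_add (i1.add i2) (i3.add i4)).trans ?_
    refine (congrArg₂ (· + ·) (integral_add i1 i2) (integral_add i3 i4)).trans ?_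
    simp only [hPP, hPQ, hQQ, add_zero, zero_add]
  have hFT : (Matrix.of fun a i => ∫ q : (Fin dn → ℝ) × (Fin dp → ℝ),
      (est q.1 a - ψ q.2 a) * √(g q)
        * ((densScore dens q.1 q.2 i + priorScore prior q.2 i) * √(g q)))
      = Matrix.of fun a i => ∫ θ, jacobianMat ψ θ a i * prior θ := by
    ext a i
    simp only [Matrix.of_apply]
    have hψd (θ) : DifferentiableAt ℝ (fun θ => ψ θ a) θ := (differentiable_pi.1 hψ a) θ
    have hjac (θ) : jacobianMat ψ θ a i = fderiv ℝ (fun θ' => ψ θ' a) θ (Pi.single i 1) := by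
      rw [(hasFDerivAt_pi'.1 (hψ θ).hasFDerivAt a).fderiv]
      rfl
    have hjm : Measurable fun θ => jacobianMat ψ θ a i := by
      simp only [hjac]
      exact measurable_fderiv_apply_const ℝ _ _
    have hjint := integrable_mul_joint (μ := (volume : Measure (Fin dn → ℝ))) hjm hpm hdens_meas
      (hEDψ_fin a i) hpos' hprob
    rw [← integral_mul_joint (μ := (volume : Measure (Fin dn → ℝ))) hjm hpm hdens_meas
      (hEDψ_fin a i) hpos' hprob]
    have hone : MemLp (fun q => 1 * √(g q)) 2 volume := by
      refine sq_int measurable_const ?_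
      have hp1 : Integrable fun θ => 1 * prior θ := by
        simpa using Integrable.of_integral_ne_zero (by simp [hprior_prob] : ∫ θ, prior θ ≠ 0)
      simp only [one_mul]
      exact (integrable_mul_joint (μ := (volume : Measure (Fin dn → ℝ)))
        measurable_const hpm hdens_meas hp1 hpos' hprob).congr (.of_forall fun q => one_mul _)
    have hFTi := mul_int (hF a) (hT i)
    have hF1 := mul_int (hF a) hone
    refine (integral_prod _ hFTi).trans ((integral_congr_ae ?_).trans (integral_prod _ hjint).symm)
    filter_upwards [hFTi.prod_right_ae, hF1.prod_right_ae, hjint.prod_right_ae] with x h1 h2 h3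
    simp only [mul_eq, mul_one, mul_assoc _ (_ + _) _, hgs] at h1 h2 h3 ⊢
    have hder (θ) : fderiv ℝ (fun θ' => est x a - ψ θ' a) θ (Pi.single i 1)
        = - jacobianMat ψ θ a i := by
      rw [fderiv_const_sub, hjac]; rfl
    rw [integral_mul_fderiv_eq_neg_fderiv_mul_of_integrable ?_ h1 h2
      (fun θ _ => (hψd θ).const_sub _) (fun θ _ => hgd x θ)]
    · simp only [hder, neg_mul, integral_neg, neg_neg, hg]
    · simp only [hder, neg_mul]
      exact h3.neg
  have key := posSemidef_schur_complement_integral_mul hF hT (by rw [hTT]; exact hinv)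
  rw [hTT, hFT] at key
  simpa only [mul_eq] using key
end
end

section
/- Integration-by-parts identity for the Bayesian score: Under the setting of Van Trees' inequality — λ : ℝᵖ → ℝ a smooth compactly supported probability density, p(·|θ) strictly positive densities on ℝⁿ continuously differentiable in θ on supp λ with zero-mean score ∫ ∇_θ p(x|θ) dx = 0, ψ : ℝᵖ → ℝᵏ differentiable with Jacobian Dψ, ψ̂ : ℝⁿ → ℝᵏ measurable, all integrands below integrable with respect to the joint density p(x, θ) = p(x|θ)λ(θ) — one has E[(ψ̂(X) − ψ(θ)) (∇_θ log(p(x|θ)λ(θ)))ᵀ] = E[Dψ(θ)], where E denotes expectation under the joint density p(x|θ)λ(θ) on ℝⁿ × ℝᵖ. In particular, taking ψ(θ) = θ gives E[(ψ̂(X) − θ)(∇_θ log(p(x|θ)λ(θ)))ᵀ] = I_p (the p × p identity). -/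
open MeasureTheory Matrix

noncomputable section

/-- Score of the joint density `θ ↦ p(x|θ)λ(θ)` in coordinate direction `i`:
`∂_{θ_i} log (p(x|θ)λ(θ)) = ∂_{θ_i} (p(x|θ)λ(θ)) / (p(x|θ)λ(θ))`. -/
def jointScore {dn dp : ℕ} (dens : (Fin dn → ℝ) → (Fin dp → ℝ) → ℝ)
    (prior : (Fin dp → ℝ) → ℝ) (x : Fin dn → ℝ) (θ : Fin dp → ℝ) (i : Fin dp) : ℝ :=
  fderiv ℝ (fun θ' => dens x θ' * prior θ') θ (Pi.single i 1) / (dens x θ * prior θ)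

open Filter Topology Asymptotics

section VanishingWeight

variable {E : Type*} [NormedAddCommGroup E] [NormedSpace ℝ E]

/-- A nonnegative differentiable weight `w` may be multiplied by a function that is only
`C¹` on the topological support of `w`: the product is differentiable everywhere. -/
theorem differentiable_mul_of_contDiffOn_tsupport {f w : E → ℝ}
    (hw : Differentiable ℝ w) (hw_nonneg : ∀ y, 0 ≤ w y)
    (hf : ContDiffOn ℝ 1 f (tsupport w)) :
    Differentiable ℝ fun y => f y * w y := by
  intro y
  by_cases hy : y ∈ tsupport w
  · by_cases hwy : w y = 0
    · have hfderiv : fderiv ℝ w y = 0 :=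
        IsLocalMin.fderiv_eq_zero (Eventually.of_forall fun z => by rw [hwy]; exact hw_nonneg z)
      have hwo : w =o[𝓝 y] fun z => z - y := by
        have h := (hw y).hasFDerivAt.isLittleO
        simpa [hfderiv, hwy] using h
      have hbdd : ∀ᶠ z in 𝓝 y, z ∈ tsupport w → |f z| < |f y| + 1 :=
        eventually_nhdsWithin_iff.mp
          (((hf.continuousOn y hy).abs).eventually (gt_mem_nhds (lt_add_one _)))
      have hO : (fun z => f z * w z) =O[𝓝 y] w := by
        refine IsBigO.of_bound (|f y| + 1) ?_
        filter_upwards [hbdd] with z hz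
        rw [norm_mul, Real.norm_eq_abs]
        by_cases hzs : z ∈ tsupport w
        · exact mul_le_mul_of_nonneg_right (hz hzs).le (norm_nonneg _)
        · simp [image_eq_zero_of_notMem_tsupport hzs]
      have hderiv : HasFDerivAt (fun z => f z * w z) (0 : E →L[ℝ] ℝ) y := by
        refine HasFDerivAt.of_isLittleO ?_
        simpa [hwy] using hO.trans_isLittleO hwo
      exact hderiv.differentiableAt
    · have hnhds : tsupport w ∈ 𝓝 y :=
        mem_of_superset (hw.continuous.isOpen_support.mem_nhds hwy) (subset_tsupport w)
      exact ((hf.contDiffAt hnhds).differentiableAt one_ne_zero).mul (hw y)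
  · have hzero : (fun z => f z * w z) =ᶠ[𝓝 y] fun _ => 0 := by
      filter_upwards [(isClosed_tsupport w).isOpen_compl.mem_nhds hy] with z hz
      simp [image_eq_zero_of_notMem_tsupport hz]
    exact (differentiableAt_const 0).congr_of_eventuallyEq hzero

end VanishingWeight

section BayesScore

variable {dn dp : ℕ} {prior : (Fin dp → ℝ) → ℝ} {dens : (Fin dn → ℝ) → (Fin dp → ℝ) → ℝ}

theorem dens_mul_prior_nonneg (hprior_nonneg : ∀ θ, 0 ≤ prior θ)
    (hdens_pos : ∀ x, ∀ θ ∈ tsupport prior, 0 < dens x θ) (x : Fin dn → ℝ) (θ : Fin dp → ℝ) :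
    0 ≤ dens x θ * prior θ := by
  by_cases hθ : θ ∈ tsupport prior
  · exact mul_nonneg (hdens_pos x θ hθ).le (hprior_nonneg θ)
  · simp [image_eq_zero_of_notMem_tsupport hθ]

/-- Multiplying the score by the joint density gives the derivative of the joint density, also
where the density vanishes. -/
theorem jointScore_mul_density (hprior_nonneg : ∀ θ, 0 ≤ prior θ)
    (hdens_pos : ∀ x, ∀ θ ∈ tsupport prior, 0 < dens x θ) (x : Fin dn → ℝ) (θ : Fin dp → ℝ)
    (i : Fin dp) :
    jointScore dens prior x θ i * (dens x θ * prior θ)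
      = fderiv ℝ (fun θ' => dens x θ' * prior θ') θ (Pi.single i 1) := by
  by_cases h : dens x θ * prior θ = 0
  · have hfderiv : fderiv ℝ (fun θ' => dens x θ' * prior θ') θ = 0 :=
      IsLocalMin.fderiv_eq_zero (Eventually.of_forall fun z => by
        simpa only [h] using dens_mul_prior_nonneg hprior_nonneg hdens_pos x z)
    simp [h, hfderiv]
  · exact div_mul_cancel₀ _ h

/-- Scalar form of the integration-by-parts identity. -/
theorem integral_sub_mul_jointScore (hprior : Differentiable ℝ prior)
    (hprior_supp : HasCompactSupport prior) (hprior_nonneg : ∀ θ, 0 ≤ prior θ)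
    (hdens_pos : ∀ x, ∀ θ ∈ tsupport prior, 0 < dens x θ)
    (hdens_diff : ∀ x, ContDiffOn ℝ 1 (fun θ' => dens x θ') (tsupport prior))
    {φ : (Fin dp → ℝ) → ℝ} (hφ : Differentiable ℝ φ) (t : (Fin dn → ℝ) → ℝ) (i : Fin dp)
    (hint_score : Integrable fun q : (Fin dn → ℝ) × (Fin dp → ℝ) =>
      (t q.1 - φ q.2) * jointScore dens prior q.1 q.2 i * (dens q.1 q.2 * prior q.2))
    (hint_deriv : Integrable fun q : (Fin dn → ℝ) × (Fin dp → ℝ) =>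
      fderiv ℝ φ q.2 (Pi.single i 1) * (dens q.1 q.2 * prior q.2)) :
    ∫ q : (Fin dn → ℝ) × (Fin dp → ℝ),
        (t q.1 - φ q.2) * jointScore dens prior q.1 q.2 i * (dens q.1 q.2 * prior q.2)
      = ∫ q : (Fin dn → ℝ) × (Fin dp → ℝ),
        fderiv ℝ φ q.2 (Pi.single i 1) * (dens q.1 q.2 * prior q.2) := by
  simp only [mul_assoc, jointScore_mul_density hprior_nonneg hdens_pos] at hint_score ⊢
  rw [Measure.volume_eq_prod] at hint_score hint_deriv ⊢
  rw [integral_prod _ hint_score, integral_prod _ hint_deriv]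
  refine integral_congr_ae ?_
  filter_upwards [hint_score.prod_right_ae, hint_deriv.prod_right_ae] with x hscore hderiv
  have hg : Differentiable ℝ fun θ => dens x θ * prior θ :=
    differentiable_mul_of_contDiffOn_tsupport hprior hprior_nonneg (hdens_diff x)
  have hdiff : Differentiable ℝ fun θ => t x - φ θ := hφ.const_sub (t x)
  have hfderiv (θ : Fin dp → ℝ) : fderiv ℝ (fun θ => t x - φ θ) θ = -fderiv ℝ φ θ :=
    fderiv_const_sub (t x)
  have hprod : Integrable fun θ => (t x - φ θ) * (dens x θ * prior θ) :=
    (hdiff.continuous.mul hg.continuous).integrable_of_hasCompactSupport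
      (hprior_supp.mul_left.mul_left)
  have hparts := integral_mul_fderiv_eq_neg_fderiv_mul_of_integrable (μ := volume)
    (f := fun θ => t x - φ θ) (g := fun θ => dens x θ * prior θ) (v := Pi.single i 1)
    (by simpa [hfderiv] using hderiv.neg) hscore hprod
    (fun θ _ => hdiff θ) (fun θ _ => hg θ)
  simpa [hfderiv, integral_neg] using hparts

theorem integrable_dens_mul_prior (hprior_cont : Continuous prior)
    (hprior_nonneg : ∀ θ, 0 ≤ prior θ) (hprior_int : Integrable prior)
    (hdens_meas : Measurable (Function.uncurry dens))
    (hdens_pos : ∀ x, ∀ θ ∈ tsupport prior, 0 < dens x θ)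
    (hdens_prob : ∀ θ ∈ tsupport prior, ∫ x, dens x θ = 1) :
    Integrable fun q : (Fin dn → ℝ) × (Fin dp → ℝ) => dens q.1 q.2 * prior q.2 := by
  have hmeas : Measurable fun q : (Fin dn → ℝ) × (Fin dp → ℝ) => dens q.1 q.2 * prior q.2 :=
    hdens_meas.mul (hprior_cont.measurable.comp measurable_snd)
  rw [Measure.volume_eq_prod, integrable_prod_iff' hmeas.aestronglyMeasurable]
  refine ⟨Eventually.of_forall fun θ => ?_, ?_⟩
  · by_cases hθ : θ ∈ tsupport prior
    · have hdens : Integrable fun x => dens x θ :=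
        Integrable.of_integral_ne_zero (by simp [hdens_prob θ hθ])
      exact hdens.mul_const (prior θ)
    · simp [image_eq_zero_of_notMem_tsupport hθ]
  · refine hprior_int.congr (Eventually.of_forall fun θ => ?_)
    simp only [Real.norm_of_nonneg (dens_mul_prior_nonneg hprior_nonneg hdens_pos _ _),
      integral_mul_const]
    by_cases hθ : θ ∈ tsupport prior
    · simp [hdens_prob θ hθ]
    · simp [image_eq_zero_of_notMem_tsupport hθ]

theorem integral_dens_mul_prior (hprior_prob : ∫ θ, prior θ = 1)
    (hdens_prob : ∀ θ ∈ tsupport prior, ∫ x, dens x θ = 1)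
    (hint : Integrable fun q : (Fin dn → ℝ) × (Fin dp → ℝ) => dens q.1 q.2 * prior q.2) :
    ∫ q : (Fin dn → ℝ) × (Fin dp → ℝ), dens q.1 q.2 * prior q.2 = 1 := by
  rw [Measure.volume_eq_prod] at hint ⊢
  rw [integral_prod_symm _ hint, ← hprior_prob]
  refine integral_congr_ae (Eventually.of_forall fun θ => ?_)
  simp only [integral_mul_const]
  by_cases hθ : θ ∈ tsupport prior
  · simp [hdens_prob θ hθ]
  · simp [image_eq_zero_of_notMem_tsupport hθ]

end BayesScore

/-- **Integration-by-parts identity for the Bayesian score.**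
Under the Van Trees regularity hypotheses,
`E[(ψ̂(X) − ψ(θ)) (∇_θ log(p(x|θ)λ(θ)))ᵀ] = E[Dψ(θ)]` under the joint density
`p(x|θ)λ(θ)`; in particular, for `ψ(θ) = θ` (with estimator `ψ̂'`), the left-hand side
is the `p × p` identity matrix. -/
theorem bayes_score_integration_by_parts {dn dp k : ℕ}
    (prior : (Fin dp → ℝ) → ℝ)
    (dens : (Fin dn → ℝ) → (Fin dp → ℝ) → ℝ)
    (ψ : (Fin dp → ℝ) → (Fin k → ℝ)) (est : (Fin dn → ℝ) → (Fin k → ℝ))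
    (est' : (Fin dn → ℝ) → (Fin dp → ℝ))
    (hprior_smooth : ContDiff ℝ (⊤ : ℕ∞) prior)
    (hprior_supp : HasCompactSupport prior)
    (hprior_nonneg : ∀ θ, 0 ≤ prior θ)
    (hprior_prob : ∫ θ, prior θ = 1)
    (hdens_meas : Measurable (Function.uncurry dens))
    (hdens_pos : ∀ x, ∀ θ ∈ tsupport prior, 0 < dens x θ)
    (hdens_prob : ∀ θ ∈ tsupport prior, ∫ x, dens x θ = 1)
    (hdens_diff : ∀ x, ContDiffOn ℝ 1 (fun θ' => dens x θ') (tsupport prior))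
    (hscore_mean : ∀ θ ∈ tsupport prior, ∀ i,
        ∫ x, fderiv ℝ (fun θ' => dens x θ') θ (Pi.single i 1) = 0)
    (hψ : Differentiable ℝ ψ)
    (hest : Measurable est) (hest' : Measurable est')
    (hint₁ : ∀ a i, Integrable fun q : (Fin dn → ℝ) × (Fin dp → ℝ) =>
        (est q.1 a - ψ q.2 a) * jointScore dens prior q.1 q.2 i
          * (dens q.1 q.2 * prior q.2))
    (hint₂ : ∀ a i, Integrable fun q : (Fin dn → ℝ) × (Fin dp → ℝ) =>
        jacobianMat ψ q.2 a i * (dens q.1 q.2 * prior q.2))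
    (hint₁' : ∀ a i, Integrable fun q : (Fin dn → ℝ) × (Fin dp → ℝ) =>
        (est' q.1 a - q.2 a) * jointScore dens prior q.1 q.2 i
          * (dens q.1 q.2 * prior q.2)) :
    ((Matrix.of fun (a : Fin k) (i : Fin dp) => ∫ q : (Fin dn → ℝ) × (Fin dp → ℝ),
        (est q.1 a - ψ q.2 a) * jointScore dens prior q.1 q.2 i
          * (dens q.1 q.2 * prior q.2))
      = Matrix.of fun (a : Fin k) (i : Fin dp) => ∫ q : (Fin dn → ℝ) × (Fin dp → ℝ),
          jacobianMat ψ q.2 a i * (dens q.1 q.2 * prior q.2))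
    ∧ ((Matrix.of fun (a : Fin dp) (i : Fin dp) => ∫ q : (Fin dn → ℝ) × (Fin dp → ℝ),
        (est' q.1 a - q.2 a) * jointScore dens prior q.1 q.2 i
          * (dens q.1 q.2 * prior q.2))
      = (1 : Matrix (Fin dp) (Fin dp) ℝ)) := by
  have hprior : Differentiable ℝ prior := hprior_smooth.differentiable (by simp)
  have hprior_int : Integrable prior :=
    hprior.continuous.integrable_of_hasCompactSupport hprior_supp
  have hcoord {m : ℕ} {φ : (Fin dp → ℝ) → (Fin m → ℝ)} (hφ : Differentiable ℝ φ) (a : Fin m)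
      (θ v : Fin dp → ℝ) : fderiv ℝ (fun θ' => φ θ' a) θ v = fderiv ℝ φ θ v a := by
    rw [fderiv_apply (hφ θ)]
    rfl
  refine ⟨?_, ?_⟩
  · ext a i
    have hint := hint₂ a i
    simp only [jacobianMat, Matrix.of_apply, ← hcoord hψ] at hint ⊢
    exact integral_sub_mul_jointScore hprior hprior_supp hprior_nonneg hdens_pos hdens_diff
      (differentiable_pi.mp hψ a) (fun x => est x a) i (hint₁ a i) hint
  · ext a i
    have hjoint := integrable_dens_mul_prior hprior.continuous hprior_nonneg hprior_int
      hdens_meas hdens_pos hdens_prob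
    have hderiv (θ : Fin dp → ℝ) : fderiv ℝ (fun θ' : Fin dp → ℝ => θ' a) θ (Pi.single i 1)
        = (1 : Matrix (Fin dp) (Fin dp) ℝ) a i := by
      rw [hcoord (φ := fun θ' => θ') differentiable_id]
      simp [Pi.single_apply, Matrix.one_apply]
    have hparts := integral_sub_mul_jointScore hprior hprior_supp hprior_nonneg hdens_pos
      hdens_diff (differentiable_apply a) (fun x => est' x a) i (hint₁' a i)
      (by simpa only [hderiv] using hjoint.const_mul _)
    simp only [hderiv, integral_const_mul, integral_dens_mul_prior hprior_prob hdens_prob hjoint,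
      mul_one] at hparts
    exact hparts
end
end

section
/- Algebraic characterization of uninformative optimal policies (Proposition 1, deterministic form): Let A ∈ ℝ^{d_x × d_x}, K ∈ ℝ^{d_u × d_x}, B ∈ ℝ^{d_x × d_u}, let Σ_w ∈ ℝ^{d_x × d_x} and J ∈ ℝ^{d_x × d_x} be positive definite, let L ∈ ℝ^{(d_x d_u) × d_θ}, and let D ∈ ℝ^{(d_u d_x) × d_θ} be any matrix (in the paper, D = the Jacobian of the optimal gain, D_θ vec K(θ)). Define the closed-loop state covariances S₀ = 0, S_{t+1} = (A − BK) S_t (A − BK)ᵀ + Σ_w, and the information matrices I^T = Σ_{t=0}^{T} Lᵀ((K S_t Kᵀ) ⊗ J)L for T ≥ 1. Then the following are equivalent: (i) there exists ṽ ∈ ℝ^{d_θ} with I^T ṽ = 0 for all T ≥ 1 and D ṽ ≠ 0; (ii) there exists ṽ ∈ ℝ^{d_θ} with Lᵀ((K Kᵀ) ⊗ J)L ṽ = 0 and D ṽ ≠ 0. -/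
open Matrix
open scoped Kronecker

/-- Congruence by `M` of a positive definite matrix has the same kernel as `M`. -/
theorem Matrix.PosDef.transpose_mul_mul_mulVec_eq_zero_iff {m n : Type*} [Fintype m] [Fintype n]
    {P : Matrix m m ℝ} (hP : P.PosDef) (M : Matrix m n ℝ) (v : n → ℝ) :
    (Mᵀ * P * M) *ᵥ v = 0 ↔ M *ᵥ v = 0 := by
  refine ⟨fun h => ?_, fun h => by rw [← mulVec_mulVec, h, mulVec_zero]⟩
  by_contra hne
  refine (hP.dotProduct_mulVec_pos hne).ne' ?_
  have hdot := congrArg (v ⬝ᵥ ·) h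
  simpa [← mulVec_mulVec, dotProduct_mulVec, vecMul_transpose] using hdot

/-- The congruence `K S Kᵀ` in the left Kronecker factor is a congruence by `Kᵀ ⊗ 1`. -/
theorem transpose_mul_kronecker_congr_mul {m n p q : Type*} [Fintype m] [Fintype n] [Fintype p]
    [DecidableEq p] (K : Matrix m n ℝ) (S : Matrix n n ℝ) (J : Matrix p p ℝ)
    (L : Matrix (m × p) q ℝ) :
    Lᵀ * ((K * S * Kᵀ) ⊗ₖ J) * L =
      ((Kᵀ ⊗ₖ (1 : Matrix p p ℝ)) * L)ᵀ * (S ⊗ₖ J) * ((Kᵀ ⊗ₖ (1 : Matrix p p ℝ)) * L) := by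
  have h : (K * S * Kᵀ) ⊗ₖ J =
      (K ⊗ₖ (1 : Matrix p p ℝ)) * (S ⊗ₖ J) * (Kᵀ ⊗ₖ (1 : Matrix p p ℝ)) := by
    simp [← mul_kronecker_mul]
  rw [h, transpose_mul, ← kroneckerMap_transpose, transpose_transpose, transpose_one]
  simp only [Matrix.mul_assoc]

/-- **Algebraic characterization of uninformative optimal policies
(Proposition 1, deterministic form).**
With closed-loop covariances `S 0 = 0`, `S (t+1) = (A − BK) (S t) (A − BK)ᵀ + Σ_w`
(`Σ_w ≻ 0`), noise information `J ≻ 0`, and information matrices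
`I T = ∑_{t=0}^{T} Lᵀ((K (S t) Kᵀ) ⊗ J)L`, there exists `ṽ` with `I T ṽ = 0` for all
`T ≥ 1` and `D ṽ ≠ 0` if and only if there exists `ṽ` with
`Lᵀ((K Kᵀ) ⊗ J)L ṽ = 0` and `D ṽ ≠ 0`. -/
theorem uninformative_algebraic_characterization {dx du dθ : ℕ}
    (A : Matrix (Fin dx) (Fin dx) ℝ) (K : Matrix (Fin du) (Fin dx) ℝ)
    (B : Matrix (Fin dx) (Fin du) ℝ)
    (Sw J : Matrix (Fin dx) (Fin dx) ℝ) (hSw : Sw.PosDef) (hJ : J.PosDef)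
    (L : Matrix (Fin du × Fin dx) (Fin dθ) ℝ)
    (D : Matrix (Fin dx × Fin du) (Fin dθ) ℝ)
    (S : ℕ → Matrix (Fin dx) (Fin dx) ℝ)
    (hS0 : S 0 = 0)
    (hSrec : ∀ t, S (t + 1) = (A - B * K) * S t * (A - B * K)ᵀ + Sw)
    (Ifun : ℕ → Matrix (Fin dθ) (Fin dθ) ℝ)
    (hIfun : ∀ T, Ifun T = ∑ t ∈ Finset.range (T + 1), Lᵀ * ((K * S t * Kᵀ) ⊗ₖ J) * L) :
    (∃ vtilde : Fin dθ → ℝ,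
        (∀ T : ℕ, 1 ≤ T → (Ifun T).mulVec vtilde = 0) ∧ D.mulVec vtilde ≠ 0)
    ↔ (∃ vtilde : Fin dθ → ℝ,
        (Lᵀ * ((K * Kᵀ) ⊗ₖ J) * L).mulVec vtilde = 0 ∧ D.mulVec vtilde ≠ 0) := by
  set M := (Kᵀ ⊗ₖ (1 : Matrix (Fin dx) (Fin dx) ℝ)) * L with hM
  have hone : Lᵀ * ((K * Kᵀ) ⊗ₖ J) * L = Mᵀ * ((1 : Matrix (Fin dx) (Fin dx) ℝ) ⊗ₖ J) * M := by
    rw [hM, ← transpose_mul_kronecker_congr_mul, Matrix.mul_one]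
  have hI : ∀ T, Ifun T = ∑ t ∈ Finset.range (T + 1), Mᵀ * (S t ⊗ₖ J) * M := fun T => by
    simp_rw [hIfun, transpose_mul_kronecker_congr_mul, hM]
  have hI1 : Ifun 1 = Mᵀ * (Sw ⊗ₖ J) * M := by
    simp [hI, Finset.sum_range_succ, hS0, hSrec]
  refine exists_congr fun v => and_congr_left fun _ => ?_
  rw [hone, (PosDef.one.kronecker hJ).transpose_mul_mul_mulVec_eq_zero_iff]
  refine ⟨fun h => ?_, fun h T _ => ?_⟩
  · rw [← (hSw.kronecker hJ).transpose_mul_mul_mulVec_eq_zero_iff, ← hI1]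
    exact h 1 le_rfl
  · rw [hI, sum_mulVec]
    exact Finset.sum_eq_zero fun t _ => by rw [← mulVec_mulVec, h, mulVec_zero]
end

section
/- Nonvanishing of the gain differential on the information singular subspace (key step of the memoryless example): Fix λ > 0 and F ∈ ℝ^{d_y × d_u}, let K = (FᵀF + λI)⁻¹ Fᵀ ∈ ℝ^{d_u × d_y}, and let ũ ∈ ℝ^{d_u} and w̃ ∈ ℝ^{d_y} be nonzero vectors with Kᵀ ũ = 0 (equivalently, ũ ∈ ker(K Kᵀ)). Then the derivative of the map Φ(F) = (FᵀF + λI)⁻¹ Fᵀ at F in the direction H = w̃ ũᵀ ∈ ℝ^{d_y × d_u} is nonzero: DΦ(F)[H] = (FᵀF + λI)⁻¹ ũ w̃ᵀ (I − F(FᵀF + λI)⁻¹Fᵀ) ≠ 0. -/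
open Matrix

section RingInverse

attribute [local instance] Matrix.linftyOpNormedRing Matrix.linftyOpNormedAlgebra

theorem hasFDerivAt_matrix_inv {n : Type*} [Fintype n] [DecidableEq n]
    {A : Matrix n n ℝ} (hA : IsUnit A) :
    HasFDerivAt (fun X : Matrix n n ℝ => X⁻¹)
      (-ContinuousLinearMap.mulLeftRight ℝ (Matrix n n ℝ) A⁻¹ A⁻¹) A := by
  obtain ⟨u, rfl⟩ := hA
  have h := hasFDerivAt_ringInverse (𝕜 := ℝ) u
  rw [← Matrix.coe_units_inv]
  exact h.congr_of_eventuallyEq (.of_forall nonsing_inv_eq_ringInverse)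

end RingInverse

attribute [local instance] Matrix.normedAddCommGroup Matrix.normedSpace

section Calculus

variable {E : Type*} [NormedAddCommGroup E] [NormedSpace ℝ E]
  {l m n : Type*} [Fintype l] [Fintype m] [Fintype n]

theorem HasFDerivAt.exists_matrix_mul {f : E → Matrix l m ℝ} {g : E → Matrix m n ℝ}
    {f' : E →L[ℝ] Matrix l m ℝ} {g' : E →L[ℝ] Matrix m n ℝ} {x : E}
    (hf : HasFDerivAt f f' x) (hg : HasFDerivAt g g' x) :
    ∃ L : E →L[ℝ] Matrix l n ℝ, HasFDerivAt (fun y => f y * g y) L x ∧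
      ∀ v, L v = f x * g' v + f' v * g x :=
  ⟨_, (LinearMap.toContinuousBilinearMap
    (LinearMap.mk₂ ℝ (fun (A : Matrix l m ℝ) (B : Matrix m n ℝ) => A * B)
      Matrix.add_mul Matrix.smul_mul Matrix.mul_add
      fun c A B => Matrix.mul_smul A c B)).hasFDerivAt_of_bilinear hf hg, fun _ => rfl⟩

theorem HasFDerivAt.exists_matrix_inv [DecidableEq n] {f : E → Matrix n n ℝ}
    {f' : E →L[ℝ] Matrix n n ℝ} {x : E} (hf : HasFDerivAt f f' x) (hx : IsUnit (f x)) :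
    ∃ L : E →L[ℝ] Matrix n n ℝ, HasFDerivAt (fun y => (f y)⁻¹) L x ∧
      ∀ v, L v = -((f x)⁻¹ * f' v * (f x)⁻¹) :=
  ⟨_, (hasFDerivAt_matrix_inv hx).comp x hf, fun _ => rfl⟩

theorem hasFDerivAt_matrix_transpose (A : Matrix m n ℝ) :
    HasFDerivAt (fun X : Matrix m n ℝ => Xᵀ)
      (LinearMap.toContinuousLinearMap (transposeLinearEquiv m n ℝ ℝ).toLinearMap) A :=
  (LinearMap.toContinuousLinearMap (transposeLinearEquiv m n ℝ ℝ).toLinearMap).hasFDerivAt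

end Calculus

section Gain

variable {m n : Type*} [Fintype m] [Fintype n] [DecidableEq n]

theorem isUnit_transpose_mul_self_add_smul_one {lam : ℝ} (hlam : 0 < lam) (F : Matrix m n ℝ) :
    IsUnit (Fᵀ * F + lam • (1 : Matrix n n ℝ)) := by
  have h1 : (Fᵀ * F).PosSemidef := by
    simpa [conjTranspose_eq_transpose_of_trivial] using posSemidef_conjTranspose_mul_self F
  exact (PosDef.posSemidef_add h1 (PosDef.one.smul hlam)).isUnit

theorem fderiv_regularized_gain_apply {lam : ℝ} (hlam : 0 < lam) (F H : Matrix m n ℝ) :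
    fderiv ℝ (fun X : Matrix m n ℝ => (Xᵀ * X + lam • (1 : Matrix n n ℝ))⁻¹ * Xᵀ) F H
      = (Fᵀ * F + lam • (1 : Matrix n n ℝ))⁻¹ * Hᵀ
        - (Fᵀ * F + lam • (1 : Matrix n n ℝ))⁻¹ * (Hᵀ * F + Fᵀ * H)
          * (Fᵀ * F + lam • (1 : Matrix n n ℝ))⁻¹ * Fᵀ := by
  have hT := hasFDerivAt_matrix_transpose F
  obtain ⟨L₁, h₁, e₁⟩ := hT.exists_matrix_mul (hasFDerivAt_id F)
  obtain ⟨L₂, h₂, e₂⟩ := (h₁.add_const (lam • (1 : Matrix n n ℝ))).exists_matrix_inv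
    (isUnit_transpose_mul_self_add_smul_one hlam F)
  obtain ⟨L₃, h₃, e₃⟩ := h₂.exists_matrix_mul hT
  refine (DFunLike.congr_fun h₃.fderiv H).trans ((e₃ H).trans ?_)
  rw [e₂, e₁]
  change (Fᵀ * F + lam • (1 : Matrix n n ℝ))⁻¹ * Hᵀ
    + -((Fᵀ * F + lam • (1 : Matrix n n ℝ))⁻¹ * (Fᵀ * H + Hᵀ * F)
      * (Fᵀ * F + lam • (1 : Matrix n n ℝ))⁻¹) * Fᵀ = _
  rw [add_comm (Fᵀ * H), Matrix.neg_mul, ← sub_eq_add_neg]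

theorem one_sub_mul_inv_mul_mul_add [DecidableEq m] {lam : ℝ} (hlam : 0 < lam)
    (F : Matrix m n ℝ) :
    (1 - F * (Fᵀ * F + lam • (1 : Matrix n n ℝ))⁻¹ * Fᵀ) * (F * Fᵀ + lam • (1 : Matrix m m ℝ))
      = lam • (1 : Matrix m m ℝ) := by
  have hA := (isUnit_iff_isUnit_det _).1 (isUnit_transpose_mul_self_add_smul_one hlam F)
  have hcomm : Fᵀ * (F * Fᵀ + lam • (1 : Matrix m m ℝ))
      = (Fᵀ * F + lam • (1 : Matrix n n ℝ)) * Fᵀ := by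
    simp [Matrix.mul_add, Matrix.add_mul, Matrix.mul_assoc]
  rw [Matrix.sub_mul, Matrix.mul_assoc _ Fᵀ, hcomm, Matrix.mul_assoc F,
    nonsing_inv_mul_cancel_left _ _ hA]
  simp

end Gain

/-- **Nonvanishing of the gain differential on the information singular subspace.**
Fix `λ > 0`, `F`, and set `K = (FᵀF + λI)⁻¹ Fᵀ`. If `ũ ≠ 0`, `w̃ ≠ 0` and `Kᵀ ũ = 0`,
then the Fréchet derivative of `Φ(F) = (FᵀF + λI)⁻¹ Fᵀ` at `F` in the direction
`H = w̃ ũᵀ` equals `(FᵀF + λI)⁻¹ ũ w̃ᵀ (I − F (FᵀF + λI)⁻¹ Fᵀ)`, and is nonzero. -/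
theorem gain_differential_nonvanishing {dy du : ℕ} (lam : ℝ) (hlam : 0 < lam)
    (F : Matrix (Fin dy) (Fin du) ℝ)
    (utilde : Fin du → ℝ) (wtilde : Fin dy → ℝ)
    (hu : utilde ≠ 0) (hw : wtilde ≠ 0)
    (hker : ((Fᵀ * F + lam • (1 : Matrix (Fin du) (Fin du) ℝ))⁻¹ * Fᵀ)ᵀ.mulVec utilde = 0) :
    fderiv ℝ
        (fun F' : Matrix (Fin dy) (Fin du) ℝ =>
          (F'ᵀ * F' + lam • (1 : Matrix (Fin du) (Fin du) ℝ))⁻¹ * F'ᵀ) F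
        (vecMulVec wtilde utilde)
      = (Fᵀ * F + lam • (1 : Matrix (Fin du) (Fin du) ℝ))⁻¹ * vecMulVec utilde wtilde
          * ((1 : Matrix (Fin dy) (Fin dy) ℝ)
            - F * (Fᵀ * F + lam • (1 : Matrix (Fin du) (Fin du) ℝ))⁻¹ * Fᵀ)
    ∧ fderiv ℝ
        (fun F' : Matrix (Fin dy) (Fin du) ℝ =>
          (F'ᵀ * F' + lam • (1 : Matrix (Fin du) (Fin du) ℝ))⁻¹ * F'ᵀ) F
        (vecMulVec wtilde utilde) ≠ 0 := by
  set A := Fᵀ * F + lam • (1 : Matrix (Fin du) (Fin du) ℝ) with hA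
  have hAunit : IsUnit A.det :=
    (isUnit_iff_isUnit_det _).1 (isUnit_transpose_mul_self_add_smul_one hlam F)
  have hH : vecMulVec wtilde utilde * (A⁻¹ * Fᵀ) = 0 := by
    rw [vecMulVec_mul, ← mulVec_transpose, hker, vecMulVec_zero]
  have key := fderiv_regularized_gain_apply hlam F (vecMulVec wtilde utilde)
  rw [transpose_vecMulVec, ← hA] at key
  have formula : A⁻¹ * vecMulVec utilde wtilde
      - A⁻¹ * (vecMulVec utilde wtilde * F + Fᵀ * vecMulVec wtilde utilde) * A⁻¹ * Fᵀ
      = A⁻¹ * vecMulVec utilde wtilde * (1 - F * A⁻¹ * Fᵀ) := by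
    simp only [Matrix.mul_add, Matrix.add_mul, Matrix.mul_sub, Matrix.mul_assoc, hH,
      Matrix.mul_zero, add_zero, Matrix.mul_one]
  rw [key, formula]
  refine ⟨rfl, fun h => ?_⟩
  have h' := congrArg (fun M => A * (M * (F * Fᵀ + lam • (1 : Matrix (Fin dy) (Fin dy) ℝ)))) h
  beta_reduce at h'
  rw [Matrix.mul_assoc _ (1 - F * A⁻¹ * Fᵀ), one_sub_mul_inv_mul_mul_add hlam F,
    Matrix.mul_assoc A⁻¹, mul_nonsing_inv_cancel_left _ _ hAunit, Matrix.mul_smul,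
    Matrix.mul_one, Matrix.zero_mul, Matrix.mul_zero] at h'
  obtain ⟨i, hi⟩ := Function.ne_iff.1 hu
  obtain ⟨j, hj⟩ := Function.ne_iff.1 hw
  exact mul_ne_zero hi hj (congrFun (congrFun ((smul_eq_zero.1 h').resolve_left hlam.ne') i) j)
end
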